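/- For every k ∈ ℕ, the antiderivative X_{2k+1}(x) = ∫_{−∞}^x h_{2k+1}(t) dt satisfies ∫_ℝ (X_{2k+1}(x))² dx = 2. -/

import Mathlib

open MeasureTheory Real

/-- The normalized Hermite function of degree `k`:
`h_k(t) = (−1)^k (2^k k! √π)^{−1/2} e^{t²/2} (d/dt)^k(e^{−t²})`. -/
noncomputable def hermiteFun (k : ℕ) (t : ℝ) : ℝ :=
  (-1 : ℝ) ^ k * ((2 : ℝ) ^ k * (Nat.factorial k : ℝ) * Real.sqrt π) ^ (-(1 : ℝ) / 2) *
    Real.exp (t ^ 2 / 2) * iteratedDeriv k (fun s : ℝ => Real.exp (-s ^ 2)) t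

/-- The antiderivative `X_{2k+1}(x) = ∫_{−∞}^x h_{2k+1}(t) dt`. -/
noncomputable def Xodd (k : ℕ) (x : ℝ) : ℝ :=
  ∫ t in Set.Iic x, hermiteFun (2 * k + 1) t

open Polynomial in
/-- The Hermite polynomials for the weight `e^{−x²}`, by the raising recursion
`H (n + 1) = 2 X H n - D (H n)`. -/
noncomputable def physHermite : ℕ → ℝ[X]
  | 0 => 1
  | n + 1 => 2 * X * physHermite n - derivative (physHermite n)

open Polynomial in
theorem derivative_physHermite_succ (n : ℕ) :
    derivative (physHermite (n + 1)) = 2 * (n + 1) * physHermite n := by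
  induction n with
  | zero => simp [physHermite]
  | succ n ih =>
    rw [physHermite, derivative_sub, ih]
    have h : derivative (2 * ((n : ℝ[X]) + 1) * physHermite n) =
        2 * ((n : ℝ[X]) + 1) * derivative (physHermite n) := by
      simp [derivative_mul]
    rw [h, derivative_mul, ih]
    simp only [derivative_mul, derivative_ofNat, derivative_X, physHermite]
    push_cast
    ring

open Polynomial in
/-- The polynomial `G` for which `G(x) e^{-x²/2}` is the antiderivative of
`H (2k + 1)(x) e^{-x²/2}`. -/
noncomputable def hermiteAntideriv : ℕ → ℝ[X]
  | 0 => -2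
  | k + 1 => 4 * (k + 1) * hermiteAntideriv k - 2 * physHermite (2 * k + 2)

open Polynomial in
theorem derivative_hermiteAntideriv_sub (k : ℕ) :
    derivative (hermiteAntideriv k) - X * hermiteAntideriv k = physHermite (2 * k + 1) := by
  induction k with
  | zero => simp [hermiteAntideriv, physHermite]; ring
  | succ k ih =>
    have h : derivative (4 * ((k : ℝ[X]) + 1) * hermiteAntideriv k) =
        4 * ((k : ℝ[X]) + 1) * derivative (hermiteAntideriv k) := by
      simp [derivative_mul]
    have h2 := derivative_physHermite_succ (2 * k + 1)
    have h3 : physHermite (2 * (k + 1) + 1) = 2 * X * physHermite (2 * k + 2) -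
      derivative (physHermite (2 * k + 2)) := rfl
    rw [hermiteAntideriv, derivative_sub, h, h3]
    simp only [derivative_mul, derivative_ofNat]
    rw [h2, ← ih]
    push_cast
    ring

theorem hasDerivAt_eval_mul_exp (p : Polynomial ℝ) (b x : ℝ) :
    HasDerivAt (fun y => p.eval y * exp (-b * y ^ 2))
      ((p.derivative - Polynomial.C (2 * b) * Polynomial.X * p).eval x * exp (-b * x ^ 2)) x := by
  refine ((p.hasDerivAt x).mul (((hasDerivAt_pow 2 x).const_mul (-b)).exp)).congr_deriv ?_
  simp
  ring

theorem integrable_eval_mul_exp (p : Polynomial ℝ) {b : ℝ} (hb : 0 < b) :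
    Integrable fun x : ℝ => p.eval x * exp (-b * x ^ 2) := by
  induction p using Polynomial.induction_on' with
  | add p q hp hq =>
    simp only [Polynomial.eval_add, add_mul]
    exact hp.add hq
  | monomial n a =>
    have h := integrable_rpow_mul_exp_neg_mul_sq hb (s := n) (by linarith [n.cast_nonneg (α := ℝ)])
    simpa [mul_assoc] using h.const_mul a

/-- Integration of a polynomial against the weight `e^{-x²}`. -/
noncomputable def gaussIntegral (p : Polynomial ℝ) : ℝ := ∫ x, p.eval x * exp (-1 * x ^ 2)

theorem gaussIntegral_sub (p q : Polynomial ℝ) :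
    gaussIntegral (p - q) = gaussIntegral p - gaussIntegral q := by
  simp only [gaussIntegral, Polynomial.eval_sub, sub_mul]
  exact integral_sub (integrable_eval_mul_exp p one_pos) (integrable_eval_mul_exp q one_pos)

theorem gaussIntegral_C_mul (a : ℝ) (p : Polynomial ℝ) :
    gaussIntegral (Polynomial.C a * p) = a * gaussIntegral p := by
  simp only [gaussIntegral, Polynomial.eval_mul, Polynomial.eval_C, mul_assoc]
  exact integral_const_mul a _

theorem gaussIntegral_mul_physHermite_succ (p : Polynomial ℝ) (n : ℕ) :
    gaussIntegral (p * physHermite (n + 1)) = gaussIntegral (p.derivative * physHermite n) := by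
  have h := integral_eq_zero_of_hasDerivAt_of_integrable
    (hasDerivAt_eval_mul_exp (p * physHermite n) 1) (integrable_eval_mul_exp _ one_pos)
    (integrable_eval_mul_exp _ one_pos)
  have h' : gaussIntegral (p.derivative * physHermite n - p * physHermite (n + 1)) = 0 := by
    rw [← h, gaussIntegral, physHermite]
    congr! 3 with x
    simp
    ring
  rw [gaussIntegral_sub] at h'
  linarith

theorem gaussIntegral_physHermite_succ_mul_succ (m n : ℕ) :
    gaussIntegral (physHermite (m + 1) * physHermite (n + 1)) =
      2 * (m + 1) * gaussIntegral (physHermite m * physHermite n) := by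
  rw [gaussIntegral_mul_physHermite_succ, derivative_physHermite_succ, ← gaussIntegral_C_mul]
  congr 1
  simp [Polynomial.C_ofNat]
  ring

theorem gaussIntegral_physHermite_mul_of_lt {m n : ℕ} (h : m < n) :
    gaussIntegral (physHermite m * physHermite n) = 0 := by
  induction m generalizing n with
  | zero =>
    obtain ⟨n, rfl⟩ := Nat.exists_eq_succ_of_ne_zero h.ne'
    rw [Nat.succ_eq_add_one, gaussIntegral_mul_physHermite_succ]
    simp [physHermite, gaussIntegral]
  | succ m ih =>
    obtain ⟨n, rfl⟩ := Nat.exists_eq_succ_of_ne_zero (Nat.ne_zero_of_lt h)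
    rw [Nat.succ_eq_add_one, gaussIntegral_physHermite_succ_mul_succ, ih (by omega), mul_zero]

theorem gaussIntegral_one : gaussIntegral 1 = √π := by
  simpa [gaussIntegral] using integral_gaussian 1

theorem gaussIntegral_physHermite_mul_self (n : ℕ) :
    gaussIntegral (physHermite n * physHermite n) = 2 ^ n * n.factorial * √π := by
  induction n with
  | zero => simp [physHermite, gaussIntegral_one]
  | succ n ih =>
    rw [gaussIntegral_physHermite_succ_mul_succ, ih, Nat.factorial_succ]
    push_cast
    ring

theorem gaussIntegral_hermiteAntideriv_mul_of_lt {k n : ℕ} (h : 2 * k < n) :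
    gaussIntegral (hermiteAntideriv k * physHermite n) = 0 := by
  induction k with
  | zero =>
    have := gaussIntegral_C_mul (-2) (physHermite 0 * physHermite n)
    rw [gaussIntegral_physHermite_mul_of_lt (by omega)] at this
    simpa [hermiteAntideriv, physHermite, Polynomial.C_ofNat] using this
  | succ k ih =>
    have e : hermiteAntideriv (k + 1) * physHermite n =
        Polynomial.C (4 * (k + 1) : ℝ) * (hermiteAntideriv k * physHermite n) -
        Polynomial.C 2 * (physHermite (2 * k + 2) * physHermite n) := by
      simp [hermiteAntideriv, Polynomial.C_ofNat]
      ring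
    rw [e, gaussIntegral_sub, gaussIntegral_C_mul, gaussIntegral_C_mul, ih (by omega),
      gaussIntegral_physHermite_mul_of_lt (by omega)]
    ring

theorem gaussIntegral_hermiteAntideriv_mul_self (k : ℕ) :
    gaussIntegral (hermiteAntideriv k * hermiteAntideriv k) =
      2 * (2 ^ (2 * k + 1) * (2 * k + 1).factorial * √π) := by
  induction k with
  | zero =>
    have := gaussIntegral_C_mul 4 1
    rw [gaussIntegral_one] at this
    have e : hermiteAntideriv 0 * hermiteAntideriv 0 = Polynomial.C 4 * 1 := by
      simp [hermiteAntideriv, Polynomial.C_ofNat]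
      norm_num
    rw [e, this]
    norm_num
    ring
  | succ k ih =>
    have e : hermiteAntideriv (k + 1) * hermiteAntideriv (k + 1) =
        Polynomial.C (16 * (k + 1) ^ 2 : ℝ) * (hermiteAntideriv k * hermiteAntideriv k) -
        (Polynomial.C (16 * (k + 1) : ℝ) * (hermiteAntideriv k * physHermite (2 * k + 2)) -
        Polynomial.C 4 * (physHermite (2 * k + 2) * physHermite (2 * k + 2))) := by
      simp [hermiteAntideriv, Polynomial.C_ofNat]
      ring
    rw [e, gaussIntegral_sub, gaussIntegral_sub, gaussIntegral_C_mul, gaussIntegral_C_mul,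
      gaussIntegral_C_mul, ih, gaussIntegral_hermiteAntideriv_mul_of_lt (by omega),
      gaussIntegral_physHermite_mul_self, show 2 * (k + 1) + 1 = 2 * k + 2 + 1 by ring,
      Nat.factorial_succ (2 * k + 2), Nat.factorial_succ (2 * k + 1)]
    push_cast
    ring

theorem iteratedDeriv_gaussian_eq_physHermite (n : ℕ) :
    iteratedDeriv n (fun s : ℝ => exp (-s ^ 2)) =
      fun s => (-1) ^ n * ((physHermite n).eval s * exp (-1 * s ^ 2)) := by
  induction n with
  | zero => simp [physHermite]
  | succ n ih =>
    rw [iteratedDeriv_succ, ih]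
    ext x
    rw [((hasDerivAt_eval_mul_exp (physHermite n) 1 x).const_mul _).deriv]
    simp [physHermite]
    ring

theorem hermiteFun_eq_physHermite (n : ℕ) (t : ℝ) :
    hermiteFun n t = (2 ^ n * n.factorial * √π) ^ (-(1 : ℝ) / 2) *
      ((physHermite n).eval t * exp (-(1 / 2) * t ^ 2)) := by
  have h : exp (-(1 / 2) * t ^ 2) = exp (t ^ 2 / 2) * exp (-1 * t ^ 2) := by
    rw [← exp_add]
    ring_nf
  have h1 : ((-1 : ℝ) ^ n) * (-1) ^ n = 1 := by
    rw [← mul_pow]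
    simp
  rw [hermiteFun, iteratedDeriv_gaussian_eq_physHermite, h]
  linear_combination ((2 ^ n * n.factorial * √π) ^ (-(1 : ℝ) / 2) *
    ((physHermite n).eval t * (exp (t ^ 2 / 2) * exp (-1 * t ^ 2)))) * h1

theorem Xodd_eq_hermiteAntideriv (k : ℕ) (x : ℝ) :
    Xodd k x = (2 ^ (2 * k + 1) * (2 * k + 1).factorial * √π) ^ (-(1 : ℝ) / 2) *
      ((hermiteAntideriv k).eval x * exp (-(1 / 2) * x ^ 2)) := by
  have hd (y : ℝ) : HasDerivAt (fun y => (hermiteAntideriv k).eval y * exp (-(1 / 2) * y ^ 2))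
      ((physHermite (2 * k + 1)).eval y * exp (-(1 / 2) * y ^ 2)) y := by
    convert hasDerivAt_eval_mul_exp (hermiteAntideriv k) (1 / 2) y using 3
    rw [← derivative_hermiteAntideriv_sub]
    simp
  have hi := (integrable_eval_mul_exp (physHermite (2 * k + 1)) one_half_pos).integrableOn
    (s := Set.Iic x)
  have ht := tendsto_zero_of_hasDerivAt_of_integrableOn_Iic (fun y _ => hd y) hi
    (integrable_eval_mul_exp (hermiteAntideriv k) one_half_pos).integrableOn
  simp only [Xodd, hermiteFun_eq_physHermite]
  rw [integral_const_mul, integral_Iic_of_hasDerivAt_of_tendsto' (fun y _ => hd y) hi ht, sub_zero]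

theorem odd_antiderivative_L2_norm (k : ℕ) :
    ∫ x : ℝ, (Xodd k x) ^ 2 = 2 := by
  set c : ℝ := 2 ^ (2 * k + 1) * (2 * k + 1).factorial * √π with hc
  have hpos : 0 < c := by positivity
  have h (x : ℝ) : Xodd k x ^ 2 =
      c⁻¹ * ((hermiteAntideriv k * hermiteAntideriv k).eval x * exp (-1 * x ^ 2)) := by
    have hexp : exp (-1 * x ^ 2) = exp (-(1 / 2) * x ^ 2) * exp (-(1 / 2) * x ^ 2) := by
      rw [← exp_add]
      ring_nf
    have hinv : c⁻¹ = c ^ (-(1 : ℝ) / 2) * c ^ (-(1 : ℝ) / 2) := by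
      rw [← rpow_add hpos, ← rpow_neg_one]
      norm_num
    rw [Xodd_eq_hermiteAntideriv, ← hc, hexp, hinv, Polynomial.eval_mul]
    ring
  simp only [h]
  rw [integral_const_mul, ← gaussIntegral, gaussIntegral_hermiteAntideriv_mul_self, ← hc]
  field_simp
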